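/- Let n ≥ 1, 0 < s < 1, and let w : ℝⁿ×ℝ → ℝ be continuous. Suppose that for every (x,t) ∈ ℝⁿ×ℝ the integral defining (∂_t−Δ)^s w(x,t) converges absolutely and (∂_t−Δ)^s w(x,t) ≥ 0. Suppose moreover that for every ε > 0 there exists K > 0 such that w(x,t) ≥ −ε whenever |x| ≥ K (for all t ∈ ℝ), and w(x,t) ≥ −ε whenever |t| ≥ K (for all x ∈ ℝⁿ). Then w(x,t) ≥ 0 for all (x,t) ∈ ℝⁿ×ℝ. -/

import Mathlib

open MeasureTheory

/-- `ℝⁿ` as Euclidean space. -/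
abbrev En (n : ℕ) := EuclideanSpace ℝ (Fin n)

/-- The normalization constant `C_{n,s} = (4π)^{-n/2} / |Γ(-s)|`. -/
noncomputable def Cns (n : ℕ) (s : ℝ) : ℝ :=
  (4 * Real.pi) ^ (-(n : ℝ) / 2) / |Real.Gamma (-s)|

/-- The (left) fully fractional heat operator `(∂_t - Δ)^s` applied to `w : ℝⁿ×ℝ → ℝ`. -/
noncomputable def leftHeat (n : ℕ) (s : ℝ) (w : En n × ℝ → ℝ)
    (x : En n) (t : ℝ) : ℝ :=
  (Cns n s / 2) *
    ∫ τ in Set.Ioi (0 : ℝ), ∫ y : En n,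
      (2 * w (x, t) - w (x + y, t - τ) - w (x - y, t - τ)) *
        (τ ^ (-((n : ℝ) / 2 + 1 + s)) * Real.exp (-‖y‖ ^ 2 / (4 * τ)))

/-- The integrand of the singular integral defining `(∂_t - Δ)^s w (x,t)`,
as a function of `(τ, y)`. -/
noncomputable def leftHeatIntegrand (n : ℕ) (s : ℝ) (w : En n × ℝ → ℝ)
    (x : En n) (t : ℝ) : ℝ × En n → ℝ :=
  fun q =>
    (2 * w (x, t) - w (x + q.2, t - q.1) - w (x - q.2, t - q.1)) *
      (q.1 ^ (-((n : ℝ) / 2 + 1 + s)) * Real.exp (-‖q.2‖ ^ 2 / (4 * q.1)))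

theorem Cns_pos (n : ℕ) {s : ℝ} (hs0 : 0 < s) (hs1 : s < 1) : 0 < Cns n s := by
  have hΓ : Real.Gamma (-s) ≠ 0 := by
    refine Real.Gamma_ne_zero fun m hm => ?_
    have hm' : s = m := by linarith
    subst hm'
    have h0 : 0 < m := by exact_mod_cast hs0
    have h1 : m < 1 := by exact_mod_cast hs1
    omega
  unfold Cns
  have := abs_pos.mpr hΓ
  positivity

/-- For absolutely convergent integrals, `leftHeat` is an integral over the product space. -/
theorem leftHeat_eq_setIntegral_prod (n : ℕ) (s : ℝ) (w : En n × ℝ → ℝ) (x : En n) (t : ℝ)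
    (h : IntegrableOn (leftHeatIntegrand n s w x t) (Set.Ioi 0 ×ˢ Set.univ)) :
    leftHeat n s w x t =
      (Cns n s / 2) * ∫ q in Set.Ioi (0 : ℝ) ×ˢ Set.univ, leftHeatIntegrand n s w x t q := by
  rw [Measure.volume_eq_prod] at h ⊢
  rw [setIntegral_prod _ h]
  simp only [Measure.restrict_univ, leftHeat, leftHeatIntegrand]

/-- A continuous function that is asymptotically nonnegative in the space and time variables and
takes a negative value attains a negative global minimum. -/
theorem exists_neg_global_min (n : ℕ) (w : En n × ℝ → ℝ) (hw_cont : Continuous w)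
    (hdecay : ∀ ε > (0 : ℝ), ∃ K > (0 : ℝ),
        (∀ (x : En n) (t : ℝ), K ≤ ‖x‖ → -ε ≤ w (x, t)) ∧
        (∀ (x : En n) (t : ℝ), K ≤ |t| → -ε ≤ w (x, t)))
    {p : En n × ℝ} (hp : w p < 0) :
    ∃ x t, w (x, t) < 0 ∧ ∀ q, w (x, t) ≤ w q := by
  obtain ⟨K, -, hKx, hKt⟩ := hdecay (-w p / 2) (by linarith)
  obtain ⟨⟨x, t⟩, hmin⟩ := hw_cont.exists_forall_le' p <| by
    rw [Filter.Eventually, Filter.mem_cocompact]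
    refine ⟨_, (isCompact_closedBall (0 : En n) K).prod (isCompact_closedBall (0 : ℝ) K), ?_⟩
    rintro ⟨x, t⟩ hxt
    simp only [Set.mem_compl_iff, Set.mem_prod, mem_closedBall_zero_iff, Real.norm_eq_abs,
      not_and_or, not_le] at hxt
    show w p ≤ w (x, t)
    rcases hxt with hx | ht
    · linarith [hKx x t hx.le]
    · linarith [hKt x t ht.le]
  exact ⟨x, t, (hmin p).trans_lt hp, hmin⟩

/-- Maximum principle: a continuous function `w` with `(∂_t−Δ)^s w ≥ 0` everywhere
(absolutely convergent integrals) which is asymptotically nonnegative as `|x| → ∞`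
(uniformly in `t`) and as `|t| → ∞` (uniformly in `x`) is nonnegative everywhere. -/
theorem maximum_principle_fully_fractional (n : ℕ) (hn : 1 ≤ n)
    (s : ℝ) (hs0 : 0 < s) (hs1 : s < 1)
    (w : En n × ℝ → ℝ) (hw_cont : Continuous w)
    (habs : ∀ (x : En n) (t : ℝ),
        IntegrableOn (leftHeatIntegrand n s w x t) (Set.Ioi 0 ×ˢ Set.univ))
    (hge : ∀ (x : En n) (t : ℝ), 0 ≤ leftHeat n s w x t)
    (hdecay : ∀ ε > (0 : ℝ), ∃ K > (0 : ℝ),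
        (∀ (x : En n) (t : ℝ), K ≤ ‖x‖ → -ε ≤ w (x, t)) ∧
        (∀ (x : En n) (t : ℝ), K ≤ |t| → -ε ≤ w (x, t))) :
    ∀ p : En n × ℝ, 0 ≤ w p := by
  by_contra! hneg
  obtain ⟨p, hp⟩ := hneg
  obtain ⟨x, t, hm, hmin⟩ := exists_neg_global_min n w hw_cont hdecay hp
  set f := leftHeatIntegrand n s w x t
  have hkernel : ∀ q : ℝ × En n, 0 < q.1 →
      0 < q.1 ^ (-((n : ℝ) / 2 + 1 + s)) * Real.exp (-‖q.2‖ ^ 2 / (4 * q.1)) :=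
    fun q hq => mul_pos (Real.rpow_pos_of_pos hq _) (Real.exp_pos _)
  have hmeas : MeasurableSet (Set.Ioi (0 : ℝ) ×ˢ (Set.univ : Set (En n))) :=
    measurableSet_Ioi.prod MeasurableSet.univ
  have hnonneg : ∀ q ∈ Set.Ioi (0 : ℝ) ×ˢ (Set.univ : Set (En n)), 0 ≤ -f q := by
    rintro q ⟨hq, -⟩
    rw [neg_nonneg]
    refine mul_nonpos_of_nonpos_of_nonneg ?_ (hkernel q hq).le
    linarith [hmin (x + q.2, t - q.1), hmin (x - q.2, t - q.1)]
  have hint : 0 ≤ ∫ q in Set.Ioi (0 : ℝ) ×ˢ Set.univ, f q := by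
    have h := hge x t
    rw [leftHeat_eq_setIntegral_prod n s w x t (habs x t)] at h
    exact nonneg_of_mul_nonneg_right h (half_pos (Cns_pos n hs0 hs1))
  obtain ⟨K, hK, -, hKt⟩ := hdecay (-w (x, t) / 2) (by linarith)
  have hpos : 0 < ∫ q in Set.Ioi (0 : ℝ) ×ˢ Set.univ, -f q := by
    rw [setIntegral_pos_iff_support_of_nonneg_ae
      (ae_restrict_of_forall_mem hmeas hnonneg) (habs x t).neg]
    have hopen : IsOpen (Set.Ioi (|t| + K) ×ˢ (Set.univ : Set (En n))) :=
      isOpen_Ioi.prod isOpen_univ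
    refine (hopen.measure_pos volume ⟨(|t| + K + 1, 0), by simp⟩).trans_le (measure_mono ?_)
    rintro q ⟨hq, -⟩
    have hq' : |t| + K < q.1 := hq
    have hq0 : 0 < q.1 := by linarith [abs_nonneg t]
    have hlarge : K ≤ |t - q.1| := by
      linarith [neg_le_abs (t - q.1), le_abs_self t]
    refine ⟨?_, hq0, trivial⟩
    rw [Function.mem_support, neg_ne_zero]
    refine (mul_neg_of_neg_of_pos ?_ (hkernel q hq0)).ne
    linarith [hKt (x + q.2) _ hlarge, hKt (x - q.2) _ hlarge]
  rw [integral_neg] at hpos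
  linarith
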